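/- arXiv:0708.0390 — 3 statements merged into one kernel-verified Lean document; each statement's English description precedes it below -/
import Mathlib

section
/- Let ρ₂ satisfy (A3) with associated function g₂, let 0 < ε < 1, s > 0, and let H = (1−ε)H₀ + εH* ∈ V_ε under the Gaussian model. If (α, θ) ∈ ℝ × ℝ^p minimizes (α', θ') ↦ ∫ ρ₂((y − α' − x'θ')/s) dH(y,x) over all (α', θ') ∈ ℝ × ℝ^p, then g₂(s/(1 + ‖θ‖²)^{1/2}) − g₂(s) ≤ ε/(1−ε), where ‖θ‖ is the Euclidean norm. -/
open MeasureTheory ProbabilityTheory Filter Set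

lemma law_aux (p : ℕ) (θ : Fin p → ℝ) :
    Measure.map (fun yx : ℝ × (Fin p → ℝ) => yx.1 - ∑ i, θ i * yx.2 i)
      ((gaussianReal 0 1).prod (Measure.pi fun _ : Fin p => gaussianReal 0 1))
      = gaussianReal 0 (Real.toNNReal (1 + ∑ i, θ i ^ 2)) := by
  have hm : Measurable (fun yx : ℝ × (Fin p → ℝ) => yx.1 - ∑ i, θ i * yx.2 i) := by fun_prop
  have : IsProbabilityMeasure (Measure.map
      (fun yx : ℝ × (Fin p → ℝ) => yx.1 - ∑ i, θ i * yx.2 i)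
      ((gaussianReal 0 1).prod (Measure.pi fun _ : Fin p => gaussianReal 0 1))) :=
    Measure.isProbabilityMeasure_map hm.aemeasurable
  apply Measure.ext_of_charFun
  ext t
  have hc : ∀ u : ℝ, ∫ x, Complex.exp (u * x * Complex.I) ∂(gaussianReal 0 1)
      = Complex.exp (-(u : ℂ) ^ 2 / 2) := by
    intro u
    rw [← charFun_apply_real, charFun_gaussianReal]
    congr 1
    simp
    ring
  rw [charFun_apply_real, charFun_gaussianReal,
    integral_map hm.aemeasurable (by fun_prop)]
  have h1 : ∀ yx : ℝ × (Fin p → ℝ),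
      Complex.exp (t * ((yx.1 - ∑ i, θ i * yx.2 i : ℝ) : ℂ) * Complex.I)
      = Complex.exp (t * yx.1 * Complex.I) *
        ∏ i, Complex.exp (((-(t * θ i) : ℝ) : ℂ) * yx.2 i * Complex.I) := by
    intro yx
    rw [← Complex.exp_sum, ← Complex.exp_add]
    congr 1
    push_cast
    rw [mul_sub, sub_mul, Finset.mul_sum, Finset.sum_mul, sub_eq_add_neg,
      ← Finset.sum_neg_distrib]
    congr 1
    refine Finset.sum_congr rfl fun i _ => ?_
    ring
  simp_rw [h1]
  rw [integral_prod_mul (fun y : ℝ => Complex.exp (t * y * Complex.I))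
    (fun x : Fin p → ℝ => ∏ i, Complex.exp (((-(t * θ i) : ℝ) : ℂ) * x i * Complex.I)),
    integral_fintype_prod_eq_prod
      (f := fun i (x : ℝ) => Complex.exp (((-(t * θ i) : ℝ) : ℂ) * x * Complex.I))]
  simp_rw [hc]
  rw [← Complex.exp_sum, ← Complex.exp_add]
  have hn : 0 ≤ 1 + ∑ i, θ i ^ 2 := by positivity
  congr 1
  rw [Real.coe_toNNReal _ hn]
  push_cast
  have h2 : ∑ x, -(-((t : ℂ) * θ x)) ^ 2 / 2 = (∑ x, (θ x : ℂ) ^ 2) * (-(t : ℂ) ^ 2 / 2) := by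
    rw [Finset.sum_mul]
    refine Finset.sum_congr rfl fun i _ => ?_
    ring
  rw [h2]
  ring

lemma anderson_aux (f : ℝ → ℝ) (hf : Measurable f) (he : ∀ u, f (-u) = f u)
    (hm : MonotoneOn f (Set.Ici 0)) (hb : ∀ u, 0 ≤ f u ∧ f u ≤ 1) (v : NNReal) (hv : v ≠ 0)
    (a : ℝ) :
    ∫ z, f z ∂(gaussianReal 0 v) ≤ ∫ z, f (z - a) ∂(gaussianReal 0 v) := by
  rw [integral_gaussianReal_eq_integral_smul hv, integral_gaussianReal_eq_integral_smul hv]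
  simp only [smul_eq_mul]
  set φ := gaussianPDFReal 0 v with hφ
  have hφe : ∀ z, φ (-z) = φ z := fun z => by simp [hφ, gaussianPDFReal]
  have hφm : ∀ x y, |x| ≤ |y| → φ y ≤ φ x := by
    intro x y h
    have h2 : x ^ 2 ≤ y ^ 2 := sq_le_sq.2 h
    simp only [hφ, gaussianPDFReal, sub_zero]
    gcongr
  have hfm : ∀ x y, |x| ≤ |y| → f x ≤ f y := by
    have habs : ∀ x, f |x| = f x := fun x => by
      rcases abs_choice x with h | h <;> rw [h]
      exact he x
    intro x y h
    rw [← habs x, ← habs y]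
    exact hm (abs_nonneg x) (abs_nonneg y) h
  have hφi : Integrable φ := integrable_gaussianPDFReal 0 v
  have hI : ∀ b c, Integrable (fun z => φ (z - b) * f (z - c)) := by
    intro b c
    refine (hφi.comp_sub_right b).mul_bdd (c := 1)
      (hf.comp (measurable_id.sub_const c)).aestronglyMeasurable (ae_of_all _ fun z => ?_)
    rw [Real.norm_eq_abs, abs_of_nonneg (hb _).1]
    exact (hb _).2
  have h00 := hI 0 0
  have h0a := hI 0 a
  have ha0 := hI a 0
  have haa := hI a a
  simp only [sub_zero] at h00 h0a ha0
  have e1 : ∫ z, φ (z - a) * f z = ∫ z, φ z * f (z - a) := by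
    rw [← integral_sub_left_eq_self (fun z => φ z * f (z - a)) volume a]
    congr with z
    rw [← hφe (z - a), ← he z]
    congr 2 <;> ring
  have e2 : ∫ z, φ (z - a) * f (z - a) = ∫ z, φ z * f z :=
    integral_sub_right_eq_self (fun z => φ z * f z) a
  have key : 0 ≤ ∫ z, ((φ z * f (z - a) - φ z * f z) - (φ (z - a) * f (z - a) - φ (z - a) * f z)) := by
    refine integral_nonneg fun z => ?_
    have : (φ z * f (z - a) - φ z * f z) - (φ (z - a) * f (z - a) - φ (z - a) * f z)
      = (φ z - φ (z - a)) * (f (z - a) - f z) := by ring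
    simp only [Pi.zero_apply]
    rw [this]
    rcases le_total |z| |z - a| with h | h
    · exact mul_nonneg (sub_nonneg.2 (hφm _ _ h)) (sub_nonneg.2 (hfm _ _ h))
    · exact mul_nonneg_of_nonpos_of_nonpos (sub_nonpos.2 (hφm _ _ h)) (sub_nonpos.2 (hfm _ _ h))
  have hX : Integrable (fun z => φ z * f (z - a) - φ z * f z) := h0a.sub h00
  have hY : Integrable (fun z => φ (z - a) * f (z - a) - φ (z - a) * f z) := haa.sub ha0
  rw [integral_sub hX hY, integral_sub h0a h00, integral_sub haa ha0,
    e1, e2] at key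
  linarith

/-- Under the Gaussian model, if (α, θ) minimizes the contaminated M-criterion
at scale s > 0 over H ∈ V_ε, then g₂(s/√(1+‖θ‖²)) − g₂(s) ≤ ε/(1−ε). -/
theorem stmt3 (p : ℕ) (hp : 1 ≤ p) (ρ₂ : ℝ → ℝ)
    (hρ_meas : Measurable ρ₂)
    (hρ_even : ∀ u, ρ₂ (-u) = ρ₂ u)
    (hρ_mono : MonotoneOn ρ₂ (Set.Ici 0))
    (hρ_zero : ρ₂ 0 = 0)
    (hρ_bdd : ∀ u, 0 ≤ ρ₂ u ∧ ρ₂ u ≤ 1)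
    (hρ_lim : Tendsto ρ₂ atTop (nhds 1))
    (g₂ : ℝ → ℝ)
    (hg₂ : ∀ s, 0 < s → g₂ s = ∫ z, ρ₂ (z / s) ∂(gaussianReal 0 1))
    (ε : ℝ) (hε : 0 < ε) (hε1 : ε < 1)
    (s : ℝ) (hs : 0 < s)
    (Hstar : Measure (ℝ × (Fin p → ℝ))) (hHstar : IsProbabilityMeasure Hstar)
    (H : Measure (ℝ × (Fin p → ℝ)))
    (hH : H = ENNReal.ofReal (1 - ε) •
        ((gaussianReal 0 1).prod (Measure.pi fun _ : Fin p => gaussianReal 0 1)) +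
        ENNReal.ofReal ε • Hstar)
    (α : ℝ) (θ : Fin p → ℝ)
    (hmin : ∀ α' : ℝ, ∀ θ' : Fin p → ℝ,
        ∫ yx, ρ₂ ((yx.1 - α - ∑ i, θ i * yx.2 i) / s) ∂H ≤
        ∫ yx, ρ₂ ((yx.1 - α' - ∑ i, θ' i * yx.2 i) / s) ∂H) :
    g₂ (s / Real.sqrt (1 + ∑ i, θ i ^ 2)) - g₂ s ≤ ε / (1 - ε) := by
  have hε' : 0 < 1 - ε := by linarith
  set H0 := ((gaussianReal 0 1).prod (Measure.pi fun _ : Fin p => gaussianReal 0 1)) with hH0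
  have hint : ∀ (μ : Measure (ℝ × (Fin p → ℝ))) [IsProbabilityMeasure μ] (α' : ℝ) (θ' : Fin p → ℝ),
      Integrable (fun yx : ℝ × (Fin p → ℝ) => ρ₂ ((yx.1 - α' - ∑ i, θ' i * yx.2 i) / s)) μ := by
    intro μ _ α' θ'
    refine Integrable.of_bound (C := 1) ?_ (ae_of_all _ fun z => ?_)
    · exact (hρ_meas.comp (by fun_prop)).aestronglyMeasurable
    · rw [Real.norm_eq_abs, abs_of_nonneg (hρ_bdd _).1]
      exact (hρ_bdd _).2
  have hsplit : ∀ (α' : ℝ) (θ' : Fin p → ℝ),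
      ∫ yx, ρ₂ ((yx.1 - α' - ∑ i, θ' i * yx.2 i) / s) ∂H
      = (1 - ε) * ∫ yx, ρ₂ ((yx.1 - α' - ∑ i, θ' i * yx.2 i) / s) ∂H0
        + ε * ∫ yx, ρ₂ ((yx.1 - α' - ∑ i, θ' i * yx.2 i) / s) ∂Hstar := by
    intro α' θ'
    rw [hH, integral_add_measure ((hint H0 α' θ').smul_measure ENNReal.ofReal_ne_top)
      ((hint Hstar α' θ').smul_measure ENNReal.ofReal_ne_top), integral_smul_measure,
      integral_smul_measure, ENNReal.toReal_ofReal hε'.le, ENNReal.toReal_ofReal hε.le]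
    simp only [smul_eq_mul]
  have hlaw : ∀ (α' : ℝ) (θ' : Fin p → ℝ),
      ∫ yx, ρ₂ ((yx.1 - α' - ∑ i, θ' i * yx.2 i) / s) ∂H0
      = ∫ z, ρ₂ ((z - α') / s) ∂(gaussianReal 0 (Real.toNNReal (1 + ∑ i, θ' i ^ 2))) := by
    intro α' θ'
    rw [← law_aux, integral_map (Measurable.aemeasurable (by fun_prop))
      (Measurable.aestronglyMeasurable (by fun_prop))]
    refine integral_congr_ae (ae_of_all _ fun yx => ?_)
    simp only
    congr 2
    ring
  have hpos : 0 < 1 + ∑ i, θ i ^ 2 := by positivity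
  have hsq : 0 < Real.sqrt (1 + ∑ i, θ i ^ 2) := Real.sqrt_pos.2 hpos
  have hg : g₂ (s / Real.sqrt (1 + ∑ i, θ i ^ 2))
      = ∫ z, ρ₂ (z / s) ∂(gaussianReal 0 (Real.toNNReal (1 + ∑ i, θ i ^ 2))) := by
    rw [hg₂ _ (div_pos hs hsq)]
    have hmap := gaussianReal_map_const_mul (μ := 0) (v := 1) (Real.sqrt (1 + ∑ i, θ i ^ 2))
    have hv : NNReal.mk (Real.sqrt (1 + ∑ i, θ i ^ 2) ^ 2) (sq_nonneg _) * 1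
        = Real.toNNReal (1 + ∑ i, θ i ^ 2) := by
      ext
      simp [Real.sq_sqrt hpos.le, Real.coe_toNNReal _ hpos.le]
    rw [mul_zero, hv] at hmap
    rw [← hmap, integral_map (Measurable.aemeasurable (by fun_prop))
      (Measurable.aestronglyMeasurable (by fun_prop))]
    refine integral_congr_ae (ae_of_all _ fun z => ?_)
    simp only
    congr 1
    field_simp
  have hand := anderson_aux (fun z => ρ₂ (z / s)) (hρ_meas.comp (by fun_prop))
    (fun u => by rw [neg_div]; exact hρ_even _)
    (fun x hx y hy h => hρ_mono (div_nonneg hx hs.le) (div_nonneg hy hs.le) (by gcongr))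
    (fun u => hρ_bdd _) (Real.toNNReal (1 + ∑ i, θ i ^ 2)) (by simpa using hpos) α
  rw [← hg, ← hlaw α θ] at hand
  have h0 := hmin 0 (fun _ => 0)
  rw [hsplit, hsplit, hlaw 0 (fun _ => 0)] at h0
  have hg0 : ∫ z, ρ₂ ((z - 0) / s) ∂(gaussianReal 0 (Real.toNNReal (1 + ∑ _i : Fin p, (0:ℝ) ^ 2)))
      = g₂ s := by
    rw [hg₂ s hs]; simp
  rw [hg0] at h0
  have hA : 0 ≤ ∫ yx, ρ₂ ((yx.1 - α - ∑ i, θ i * yx.2 i) / s) ∂Hstar :=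
    integral_nonneg fun _ => (hρ_bdd _).1
  have hB : ∫ yx, ρ₂ ((yx.1 - 0 - ∑ i, (0:ℝ) * yx.2 i) / s) ∂Hstar ≤ 1 := by
    have := integral_mono (hint Hstar 0 (fun _ => 0)) (integrable_const (1:ℝ))
      (fun _ => (hρ_bdd _).2)
    simpa using this
  rw [le_div_iff₀ hε']
  have h3 := mul_le_mul_of_nonneg_left hand hε'.le
  have h4 := mul_nonneg hε.le hA
  have h5 := mul_le_mul_of_nonneg_left hB hε.le
  nlinarith
end

section
/- Let ρ satisfy (A3), let 0 < ε < b < 1, and let H ∈ V_ε under the Gaussian model. Suppose (α, θ, σ) with σ > 0 satisfies the constraint ∫ ρ((y − α − x'θ)/σ) dH(y,x) ≤ b and is a minimizer of σ, i.e., σ ≤ σ' for every (α', θ', σ') with σ' > 0 and ∫ ρ((y − α' − x'θ')/σ') dH(y,x) ≤ b. Then ‖θ‖ ≤ ((σ_{b,ε}/γ_{b,ε})² − 1)^{1/2}. -/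
open MeasureTheory ProbabilityTheory Filter Set

lemma stmt6_law (p : ℕ) (θ : Fin p → ℝ) :
    ((gaussianReal 0 1).prod (Measure.pi fun _ : Fin p => gaussianReal 0 1)).map
      (fun yx : ℝ × (Fin p → ℝ) => yx.1 - ∑ i, θ i * yx.2 i)
      = gaussianReal 0 (1 + ∑ i, θ i ^ 2).toNNReal := by
  have hm : Measurable (fun yx : ℝ × (Fin p → ℝ) => yx.1 - ∑ i, θ i * yx.2 i) := by
    fun_prop
  have : IsProbabilityMeasure
    (((gaussianReal 0 1).prod (Measure.pi fun _ : Fin p => gaussianReal 0 1)).map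
      (fun yx : ℝ × (Fin p → ℝ) => yx.1 - ∑ i, θ i * yx.2 i)) :=
    Measure.isProbabilityMeasure_map hm.aemeasurable
  apply Measure.ext_of_charFun
  ext t
  have hs : 0 ≤ ∑ i, θ i ^ 2 := Finset.sum_nonneg (fun i _ => sq_nonneg _)
  have key : ∀ t : ℝ, ∫ x : ℝ, Complex.exp (t * x * Complex.I) ∂(gaussianReal 0 1)
      = Complex.exp (-(t:ℂ) ^ 2 / 2) := by
    intro t
    have h := charFun_gaussianReal (μ := 0) (v := 1) t
    rw [charFun_apply_real] at h
    rw [h]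
    congr 1
    simp
    ring
  rw [charFun_apply_real, charFun_gaussianReal, integral_map hm.aemeasurable
    (by fun_prop)]
  have e1 : ∀ yx : ℝ × (Fin p → ℝ),
      Complex.exp (t * ((yx.1 - ∑ i, θ i * yx.2 i : ℝ) : ℂ) * Complex.I)
      = Complex.exp (t * yx.1 * Complex.I) *
        ∏ i, Complex.exp (((-(t * θ i) : ℝ) : ℂ) * yx.2 i * Complex.I) := by
    intro yx
    rw [← Complex.exp_sum, ← Complex.exp_add]
    congr 1
    push_cast
    rw [← Finset.sum_mul, mul_sub, Finset.mul_sum, sub_mul, sub_eq_add_neg, ← neg_mul,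
      ← Finset.sum_neg_distrib]
    congr 2
    apply Finset.sum_congr rfl
    intro i _
    ring
  simp_rw [e1]
  rw [integral_prod_mul (fun y : ℝ => Complex.exp (t * y * Complex.I))
    (fun x : Fin p → ℝ => ∏ i, Complex.exp (((-(t * θ i) : ℝ) : ℂ) * x i * Complex.I)),
    integral_fintype_prod_eq_prod
      (fun i (x : ℝ) => Complex.exp (((-(t * θ i) : ℝ) : ℂ) * x * Complex.I))]
  simp_rw [key]
  rw [← Complex.exp_sum, ← Complex.exp_add]
  congr 1
  have : (((1 + ∑ i, θ i ^ 2).toNNReal : ℝ) : ℂ) = 1 + ∑ i, (θ i : ℂ) ^ 2 := by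
    rw [Real.coe_toNNReal _ (by linarith)]
    push_cast
    rfl
  rw [this]
  push_cast
  have e2 : ∑ i, -(-((t:ℂ) * θ i)) ^ 2 / 2 = - (∑ i, (θ i : ℂ) ^ 2) * t ^ 2 / 2 := by
    rw [← Finset.sum_neg_distrib, Finset.sum_mul, Finset.sum_div]
    apply Finset.sum_congr rfl
    intro i _
    ring
  rw [e2]
  ring

lemma stmt6_abs_mono {ρ : ℝ → ℝ} (hρ_even : ∀ u, ρ (-u) = ρ u)
    (hρ_mono : MonotoneOn ρ (Set.Ici 0)) {u v : ℝ} (h : |u| ≤ |v|) : ρ u ≤ ρ v := by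
  have ha : ∀ u, ρ |u| = ρ u := by
    intro u
    rcases abs_choice u with h | h <;> rw [h]
    exact hρ_even u
  rw [← ha u, ← ha v]
  exact hρ_mono (abs_nonneg u) (abs_nonneg v) h

lemma stmt6_shift {r : ℝ → ℝ} (hm : Measurable r) (hb : ∀ u, 0 ≤ r u ∧ r u ≤ 1)
    (hr : ∀ u v, |u| ≤ |v| → r u ≤ r v) (a : ℝ) :
    ∫ z, r z ∂(gaussianReal 0 1) ≤ ∫ z, r (z - a) ∂(gaussianReal 0 1) := by
  set φ := gaussianPDFReal 0 1 with hφ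
  have hφe : ∀ u v, |u| ≤ |v| → φ v ≤ φ u := by
    intro u v h
    simp only [hφ, gaussianPDFReal_def]
    have := sq_le_sq.mpr h
    refine mul_le_mul_of_nonneg_left (Real.exp_le_exp.mpr ?_) (by positivity)
    simp only [sub_zero, NNReal.coe_one, mul_one]
    linarith
  have hφi : Integrable φ := integrable_gaussianPDFReal 0 1
  have hint : ∀ f h : ℝ → ℝ, Measurable f → (∀ u, 0 ≤ f u ∧ f u ≤ 1) → Integrable h →
      Integrable (fun z => h z * f z) := by
    intro f h hf hb hh
    refine hh.mul_bdd (c := 1) hf.aestronglyMeasurable (ae_of_all _ fun z => ?_)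
    rw [Real.norm_eq_abs, abs_of_nonneg (hb z).1]
    exact (hb z).2
  have hφa : Integrable (fun z => φ (z + a)) := hφi.comp_add_right a
  have hneg : ∀ u, φ (-u) = φ u := fun u =>
    le_antisymm (hφe _ _ (by simp)) (hφe _ _ (by simp))
  have hrneg : ∀ u, r (-u) = r u := fun u =>
    le_antisymm (hr _ _ (by simp)) (hr _ _ (by simp))
  rw [integral_gaussianReal_eq_integral_smul one_ne_zero,
    integral_gaussianReal_eq_integral_smul one_ne_zero]
  simp only [smul_eq_mul, ← hφ]
  -- A : ∫ φ z r z, B : ∫ φ z r (z-a)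
  have hB : ∫ z, φ z * r (z - a) = ∫ z, φ (z + a) * r z := by
    rw [← integral_add_right_eq_self (fun z => φ z * r (z - a)) a]
    simp
  have hA2 : ∫ z, φ (z + a) * r (z + a) = ∫ z, φ z * r z :=
    integral_add_right_eq_self (fun z => φ z * r z) a
  have hB2 : ∫ z, φ z * r (z + a) = ∫ z, φ z * r (z - a) := by
    rw [← integral_neg_eq_self]
    refine integral_congr_ae (ae_of_all _ fun z => ?_)
    simp only
    rw [hneg, ← hrneg]
    congr 2
    ring
  have hra : Measurable (fun z => r (z + a)) := by fun_prop
  have i1 := hint r φ hm hb hφi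
  have i2 := hint r _ hm hb hφa
  have i3 := hint _ φ hra (fun u => hb _) hφi
  have i4 := hint _ _ hra (fun u => hb _) hφa
  have hpos : 0 ≤ ∫ z, ((φ (z + a) * r z - φ z * r z) +
      (φ z * r (z + a) - φ (z + a) * r (z + a))) := by
    apply integral_nonneg
    intro z
    have : (φ (z + a) * r z - φ z * r z) +
      (φ z * r (z + a) - φ (z + a) * r (z + a)) = (φ (z + a) - φ z) * (r z - r (z + a)) := by
      ring
    simp only [Pi.zero_apply]
    rw [this]
    rcases le_total |z| |z + a| with h | h
    · exact mul_nonneg_of_nonpos_of_nonpos (by linarith [hφe _ _ h]) (by linarith [hr _ _ h])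
    · exact mul_nonneg (by linarith [hφe _ _ h]) (by linarith [hr _ _ h])
  have hadd := integral_add (i2.sub i1) (i3.sub i4)
  simp only [Pi.sub_apply] at hadd
  rw [hadd, integral_sub i2 i1, integral_sub i3 i4, hA2, hB2,
    ← hB] at hpos
  linarith

/-- strict monotonicity of `g`, except in the degenerate case. -/
lemma stmt6_strict {ρ : ℝ → ℝ} (hρ_meas : Measurable ρ)
    (hr : ∀ u v, |u| ≤ |v| → ρ u ≤ ρ v)
    (hb : ∀ u, 0 ≤ ρ u ∧ ρ u ≤ 1) (hρ_lim : Tendsto ρ atTop (nhds 1))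
    {u γ : ℝ} (hu : 0 < u) (huγ : u < γ)
    (hle : ∫ z, ρ (z / u) ∂(gaussianReal 0 1) ≤ ∫ z, ρ (z / γ) ∂(gaussianReal 0 1))
    {s : ℝ} (hs : 0 < s) : ∫ z, ρ (z / s) ∂(gaussianReal 0 1) = 1 := by
  have hγ : 0 < γ := hu.trans huγ
  have hint : ∀ s, Integrable (fun z => ρ (z / s)) (gaussianReal 0 1) := by
    intro s
    refine Integrable.of_bound
      (hρ_meas.comp (measurable_id.div_const s)).aestronglyMeasurable 1 (ae_of_all _ fun z => ?_)
    rw [Real.norm_eq_abs, abs_of_nonneg (hb _).1]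
    exact (hb _).2
  have hpt : ∀ z, ρ (z / γ) ≤ ρ (z / u) := by
    intro z
    apply hr
    rw [abs_div, abs_div, abs_of_pos hu, abs_of_pos hγ]
    gcongr
  have hae : (fun z => ρ (z / γ)) =ᵐ[gaussianReal 0 1] (fun z => ρ (z / u)) :=
    (integral_eq_iff_of_ae_le (hint γ) (hint u) (ae_of_all _ hpt)).mp
      (le_antisymm (integral_mono (hint γ) (hint u) hpt) hle)
  have hvol : ∀ᵐ z : ℝ, ρ (z / γ) = ρ (z / u) :=
    (gaussianReal_absolutelyContinuous' 0 one_ne_zero).ae_le hae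
  have hscale : ∀ c : ℝ, 0 < c → ∀ᵐ z : ℝ, ρ (c * z / γ) = ρ (c * z / u) := by
    intro c hc
    have hq : Measure.QuasiMeasurePreserving (fun z : ℝ => c * z) volume volume := by
      refine ⟨by fun_prop, ?_⟩
      rw [Real.map_volume_mul_left hc.ne']
      exact Measure.smul_absolutelyContinuous
    exact hq.ae hvol
  have hall : ∀ᵐ z : ℝ, ∀ n : ℕ, ρ ((γ * (γ / u) ^ n / s) * z / γ)
      = ρ ((γ * (γ / u) ^ n / s) * z / u) := by
    rw [ae_all_iff]
    intro n
    exact hscale _ (by positivity)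
  have hne : ∀ᵐ z : ℝ, z ≠ 0 := by
    simp [ae_iff]
  have hone : ∀ᵐ z : ℝ, ρ (z / s) = 1 := by
    filter_upwards [hall, hne] with z hz hz0
    have hn : ∀ n : ℕ, ρ ((γ / u) ^ n * (z / s)) = ρ (z / s) := by
      intro n
      induction n with
      | zero => simp
      | succ n ih =>
        rw [← ih]
        have h := hz n
        have e1 : (γ * (γ / u) ^ n / s) * z / γ = (γ / u) ^ n * (z / s) := by
          field_simp
        have e2 : (γ * (γ / u) ^ n / s) * z / u = (γ / u) ^ (n + 1) * (z / s) := by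
          rw [pow_succ]
          field_simp
        rw [e1, e2] at h
        exact h.symm
    have habs : ∀ n : ℕ, ρ ((γ / u) ^ n * |z / s|) = ρ (z / s) := by
      intro n
      rw [← hn n]
      have : abs ((γ / u) ^ n * abs (z / s)) = abs ((γ / u) ^ n * (z / s)) := by
        rw [abs_mul, abs_mul, abs_abs]
      exact le_antisymm (hr _ _ this.le) (hr _ _ this.ge)
    have ht : Tendsto (fun n : ℕ => (γ / u) ^ n * |z / s|) atTop atTop :=
      (tendsto_pow_atTop_atTop_of_one_lt ((one_lt_div hu).mpr huγ)).atTop_mul_const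
        (abs_pos.mpr (div_ne_zero hz0 hs.ne'))
    have h2 := hρ_lim.comp ht
    simp only [Function.comp_def, habs] at h2
    exact tendsto_nhds_unique tendsto_const_nhds h2
  have hone' : (fun z => ρ (z / s)) =ᵐ[gaussianReal 0 1] fun _ => (1 : ℝ) :=
    (gaussianReal_absolutelyContinuous 0 one_ne_zero).ae_le hone
  rw [integral_congr_ae hone']
  simp

/-- Under the Gaussian model, the slope θ of any S-estimate solution over
H ∈ V_ε satisfies ‖θ‖ ≤ ((σ_{b,ε}/γ_{b,ε})² − 1)^{1/2}. -/
theorem stmt6 (p : ℕ) (hp : 1 ≤ p) (ρ : ℝ → ℝ)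
    (hρ_meas : Measurable ρ)
    (hρ_even : ∀ u, ρ (-u) = ρ u)
    (hρ_mono : MonotoneOn ρ (Set.Ici 0))
    (hρ_zero : ρ 0 = 0)
    (hρ_bdd : ∀ u, 0 ≤ ρ u ∧ ρ u ≤ 1)
    (hρ_lim : Tendsto ρ atTop (nhds 1))
    (g : ℝ → ℝ)
    (hg : ∀ s, 0 < s → g s = ∫ z, ρ (z / s) ∂(gaussianReal 0 1))
    (b ε : ℝ) (hε : 0 < ε) (hεb : ε < b) (hb : b < 1)
    (σbε γbε : ℝ) (hσ_pos : 0 < σbε) (hγ_pos : 0 < γbε)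
    (hσ : g σbε = (b - ε) / (1 - ε)) (hγ : g γbε = b / (1 - ε))
    (Hstar : Measure (ℝ × (Fin p → ℝ))) (hHstar : IsProbabilityMeasure Hstar)
    (H : Measure (ℝ × (Fin p → ℝ)))
    (hH : H = ENNReal.ofReal (1 - ε) •
        ((gaussianReal 0 1).prod (Measure.pi fun _ : Fin p => gaussianReal 0 1)) +
        ENNReal.ofReal ε • Hstar)
    (α : ℝ) (θ : Fin p → ℝ) (σ : ℝ) (hσpos : 0 < σ)
    (hfeas : ∫ yx, ρ ((yx.1 - α - ∑ i, θ i * yx.2 i) / σ) ∂H ≤ b)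
    (hmin : ∀ α' : ℝ, ∀ θ' : Fin p → ℝ, ∀ σ' : ℝ, 0 < σ' →
        (∫ yx, ρ ((yx.1 - α' - ∑ i, θ' i * yx.2 i) / σ') ∂H ≤ b) → σ ≤ σ') :
    Real.sqrt (∑ i, θ i ^ 2) ≤ Real.sqrt ((σbε / γbε) ^ 2 - 1) := by
  have h1ε : 0 < 1 - ε := by linarith
  have hr : ∀ u v, |u| ≤ |v| → ρ u ≤ ρ v := fun u v h => stmt6_abs_mono hρ_even hρ_mono h
  set μ := (gaussianReal 0 1).prod (Measure.pi fun _ : Fin p => gaussianReal 0 1) with hμ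
  have hint : ∀ (ν : Measure (ℝ × (Fin p → ℝ))) [IsFiniteMeasure ν] (α : ℝ) (θ : Fin p → ℝ)
      (σ : ℝ), Integrable (fun yx => ρ ((yx.1 - α - ∑ i, θ i * yx.2 i) / σ)) ν := by
    intro ν _ α θ σ
    refine Integrable.of_bound (C := 1) ?_ (ae_of_all _ fun z => ?_)
    · apply Measurable.aestronglyMeasurable
      fun_prop
    · rw [Real.norm_eq_abs, abs_of_nonneg (hρ_bdd _).1]
      exact (hρ_bdd _).2
  have hsplit : ∀ (α : ℝ) (θ : Fin p → ℝ) (σ : ℝ),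
      ∫ yx, ρ ((yx.1 - α - ∑ i, θ i * yx.2 i) / σ) ∂H =
      (1 - ε) * ∫ yx, ρ ((yx.1 - α - ∑ i, θ i * yx.2 i) / σ) ∂μ +
      ε * ∫ yx, ρ ((yx.1 - α - ∑ i, θ i * yx.2 i) / σ) ∂Hstar := by
    intro α θ σ
    rw [hH, integral_add_measure ((hint μ α θ σ).smul_measure ENNReal.ofReal_ne_top)
      ((hint Hstar α θ σ).smul_measure ENNReal.ofReal_ne_top), integral_smul_measure,
      integral_smul_measure, ENNReal.toReal_ofReal h1ε.le, ENNReal.toReal_ofReal hε.le]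
    rfl
  have hS0 : 0 ≤ ∑ i, θ i ^ 2 := Finset.sum_nonneg (fun i _ => sq_nonneg _)
  -- integral under the model
  have hmodel : ∀ (α : ℝ) (θ : Fin p → ℝ) (σ : ℝ),
      ∫ yx, ρ ((yx.1 - α - ∑ i, θ i * yx.2 i) / σ) ∂μ =
      ∫ z, ρ ((Real.sqrt (1 + ∑ i, θ i ^ 2) * z - α) / σ) ∂(gaussianReal 0 1) := by
    intro α θ σ
    have hS : 0 ≤ ∑ i, θ i ^ 2 := Finset.sum_nonneg (fun i _ => sq_nonneg _)
    have hmm : Measurable (fun w : ℝ => ρ ((w - α) / σ)) := by fun_prop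
    have h1 := integral_map (μ := μ)
      (φ := fun yx : ℝ × (Fin p → ℝ) => yx.1 - ∑ i, θ i * yx.2 i)
      (by fun_prop) (f := fun w : ℝ => ρ ((w - α) / σ)) hmm.aestronglyMeasurable
    have h2 := integral_map (μ := gaussianReal 0 1)
      (φ := fun z : ℝ => Real.sqrt (1 + ∑ i, θ i ^ 2) * z)
      (by fun_prop) (f := fun w : ℝ => ρ ((w - α) / σ)) hmm.aestronglyMeasurable
    rw [hμ, stmt6_law] at h1
    rw [gaussianReal_map_const_mul] at h2
    rw [← h2]
    have e : gaussianReal (Real.sqrt (1 + ∑ i, θ i ^ 2) * 0)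
        (NNReal.mk (Real.sqrt (1 + ∑ i, θ i ^ 2) ^ 2) (sq_nonneg _) * 1)
        = gaussianReal 0 (1 + ∑ i, θ i ^ 2).toNNReal := by
      congr 1
      · simp
      · rw [mul_one]
        apply NNReal.coe_injective
        change Real.sqrt (1 + ∑ i, θ i ^ 2) ^ 2 = _
        rw [Real.sq_sqrt (by linarith), Real.coe_toNNReal _ (by linarith)]
    rw [e]
    rw [h1]
    refine integral_congr_ae (ae_of_all _ fun yx => ?_)
    simp only
    rw [sub_right_comm]
  -- upper bound on σ
  have hσle : σ ≤ σbε := by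
    apply hmin 0 0 σbε hσ_pos
    rw [hsplit, hmodel]
    have e : ∫ z, ρ ((Real.sqrt (1 + ∑ i, (0 : Fin p → ℝ) i ^ 2) * z - 0) / σbε)
        ∂(gaussianReal 0 1) = (b - ε) / (1 - ε) := by
      rw [← hσ, hg _ hσ_pos]
      simp
    rw [e]
    have h2 : ∫ yx, ρ ((yx.1 - 0 - ∑ i, (0 : Fin p → ℝ) i * yx.2 i) / σbε) ∂Hstar ≤ 1 := by
      calc _ ≤ ∫ yx, (1 : ℝ) ∂Hstar :=
            integral_mono (hint Hstar 0 0 σbε) (integrable_const _) (fun z => (hρ_bdd _).2)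
        _ = 1 := by simp
    rw [mul_div_cancel₀ _ h1ε.ne']
    nlinarith
  set s := Real.sqrt (1 + ∑ i, θ i ^ 2) with hs
  have hspos : 0 < s := Real.sqrt_pos.mpr (by linarith)
  have hmain : γbε ≤ σ / s := by
    by_contra! hlt
    rw [hsplit, hmodel] at hfeas
    have h0 : 0 ≤ ∫ yx, ρ ((yx.1 - α - ∑ i, θ i * yx.2 i) / σ) ∂Hstar :=
      integral_nonneg fun z => (hρ_bdd _).1
    have hsh := stmt6_shift (r := fun z => ρ (z / (σ / s))) (by fun_prop) (fun u => hρ_bdd _)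
      (fun u v h => by
        apply hr
        rw [abs_div u, abs_div v]
        exact div_le_div_of_nonneg_right h (abs_nonneg _)) (α / s)
    have e : ∀ z, (z - α / s) / (σ / s) = (s * z - α) / σ := by
      intro z
      field_simp
    simp only [e] at hsh
    have hle : ∫ z, ρ (z / (σ / s)) ∂(gaussianReal 0 1)
        ≤ ∫ z, ρ (z / γbε) ∂(gaussianReal 0 1) := by
      rw [← hg γbε hγ_pos, hγ]
      refine hsh.trans ?_
      rw [le_div_iff₀ h1ε, mul_comm]
      have := mul_nonneg hε.le h0
      linarith
    have h1 := stmt6_strict hρ_meas hr hρ_bdd hρ_lim (div_pos hσpos hspos) hlt hle hσ_pos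
    rw [← hg _ hσ_pos, hσ, div_eq_one_iff_eq h1ε.ne'] at h1
    linarith
  apply Real.sqrt_le_sqrt
  have h3 : s ≤ σbε / γbε := by
    rw [le_div_iff₀ hγ_pos]
    rw [le_div_iff₀ hspos] at hmain
    linarith
  have h4 : s ^ 2 ≤ (σbε / γbε) ^ 2 := by gcongr
  rw [hs, Real.sq_sqrt (by linarith)] at h4
  linarith
end

section
/- Let ρ satisfy (A3), suppose g satisfies (A4), let 0 < b < 1, and assume: g is convex on (0,∞), g(σ_M) < b, and φ(σ_{b,0}) ≥ (1 − g(σ_M))²(1 − b) / (2 − (b + g(σ_M))), where σ_{b,0} = g⁻¹(b). Then c₁ := log(σ_M/σ_{b,0}) / (b − g(σ_M)) < 1/φ(σ_{b,0}) = c_o := inf{c(ε) : 0 < ε < b} (so the interval (c₁, c_o] is nonempty), and for every c with c₁ < c ≤ c_o one has B_CM(ε) ≤ B_S(ε) for every ε ∈ (0, b) and B_CM(ε) < B_S(ε) for at least one ε ∈ (0, b). -/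
open MeasureTheory ProbabilityTheory Filter Set

lemma aux_num (ε b φ y : ℝ) (hε : 0 < ε) (hε1 : ε < 1) (hb0 : 0 < b) (hb1 : b < 1)
    (hφ : (1 - b) ^ 2 / 2 < φ) (hy : 0 ≤ y) (hyx : y ≤ ε * (1 - b) / ((1 - ε) * φ)) :
    (1 - ε) * y - ε ^ 2 * b / ((1 - ε) * φ) < Real.log (1 + y) := by
  have hφ0 : 0 < φ := lt_of_le_of_lt (by positivity) hφ
  have h1ε : 0 < 1 - ε := by linarith
  refine lt_of_lt_of_le ?_ (Real.le_log_one_add_of_nonneg hy)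
  rw [lt_div_iff₀ (by linarith)]
  obtain ⟨r, hr⟩ : ∃ r, r = 1 / ((1 - ε) * φ) := ⟨_, rfl⟩
  have hr0 : 0 < r := by rw [hr]; positivity
  have hrφ : r * ((1 - ε) * φ) = 1 := by rw [hr]; field_simp
  have e1 : ε ^ 2 * b / ((1 - ε) * φ) = ε ^ 2 * b * r := by rw [hr]; ring
  have e2 : ε * (1 - b) / ((1 - ε) * φ) = ε * (1 - b) * r := by rw [hr]; ring
  rw [e2] at hyx
  rw [e1]
  -- (1-ε) y^2 ≤ y * ε * (1-b) / φ
  obtain ⟨q, hq⟩ : ∃ q, q = (1 - ε) * r := ⟨_, rfl⟩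
  have hq0 : 0 < q := by rw [hq]; positivity
  have hqφ : q * φ = 1 := by rw [hq]; linarith
  have h1 : (1 - ε) * y * y ≤ y * (ε * (1 - b) * q) := by
    have := mul_le_mul_of_nonneg_left hyx (mul_nonneg h1ε.le hy)
    rw [hq]; linarith
  have h2 : (1 - b) ^ 2 * q < 2 := by
    have : (1 - b) ^ 2 * q < 2 * φ * q := by
      apply mul_lt_mul_of_pos_right _ hq0; linarith
    linarith
  have hκ : 0 < ε ^ 2 * b * r := by positivity
  have h3 : 0 < ε * y * (2 - (1 - b) * q) + 2 * (ε ^ 2 * b * r) := by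
    rcases le_total ((1 - b) * q) 2 with h | h
    · have : 0 ≤ ε * y * (2 - (1 - b) * q) := mul_nonneg (by positivity) (by linarith)
      linarith
    · have h4 : ε * y * ((1 - b) * q - 2) ≤ ε * (ε * (1 - b) * r) * ((1 - b) * q - 2) := by
        apply mul_le_mul_of_nonneg_right _ (by linarith)
        exact mul_le_mul_of_nonneg_left hyx hε.le
      have h5 : 0 < ε ^ 2 * r * (2 - (1 - b) ^ 2 * q) :=
        mul_pos (by positivity) (by linarith)
      nlinarith
  have hκy : 0 ≤ (ε ^ 2 * b * r) * y := by positivity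
  nlinarith

lemma aux_analytic (ρ : ℝ → ℝ) (hρ_meas : Measurable ρ)
    (hρ_bdd : ∀ u, 0 ≤ ρ u ∧ ρ u ≤ 1) (g : ℝ → ℝ)
    (hg : ∀ s, 0 < s → g s = ∫ z, ρ (z / s) ∂(gaussianReal 0 1)) :
    AnalyticOnNhd ℝ g (Ioi 0) := by
  let μ : Measure ℝ := volume.withDensity (fun u => ENNReal.ofReal (ρ u))
  let X : ℝ → ℝ := fun u => -u ^ 2 / 2
  have hint : Ioi (0:ℝ) ⊆ integrableExpSet X μ := by
    intro t ht
    have ht : 0 < t := ht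
    show Integrable (fun u => Real.exp (t * X u)) μ
    rw [integrable_withDensity_iff_integrable_smul' (by fun_prop) (by simp)]
    have h1 : Integrable (fun u : ℝ => Real.exp (-(t/2) * u ^ 2)) :=
      integrable_exp_neg_mul_sq (by positivity)
    refine h1.mono' (by fun_prop) (ae_of_all _ fun u => ?_)
    simp only [X, smul_eq_mul, norm_mul, Real.norm_eq_abs, Real.abs_exp,
      ENNReal.toReal_ofReal (hρ_bdd u).1, abs_of_nonneg (hρ_bdd u).1]
    have e : t * (-u ^ 2 / 2) = -(t/2) * u ^ 2 := by ring
    rw [e]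
    have := (hρ_bdd u).2
    have := Real.exp_pos (-(t/2) * u ^ 2)
    nlinarith
  have hint' : Ioi (0:ℝ) ⊆ interior (integrableExpSet X μ) :=
    interior_maximal hint isOpen_Ioi
  have heq : ∀ s ∈ Ioi (0:ℝ), g s = s * (√(2 * Real.pi))⁻¹ * mgf X μ (s ^ 2) := by
    intro s hs
    have hs : 0 < s := hs
    rw [hg s hs, integral_gaussianReal_eq_integral_smul (by norm_num), mgf,
      integral_withDensity_eq_integral_toReal_smul (by fun_prop) (by simp)]
    have := Measure.integral_comp_div
      (fun u => gaussianPDFReal 0 1 (s * u) • ρ u) s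
    have e : (fun x => gaussianPDFReal 0 1 x • ρ (x / s)) = fun x =>
        gaussianPDFReal 0 1 (s * (x / s)) • ρ (x / s) := by
      funext x; rw [mul_div_cancel₀ _ hs.ne']
    rw [e, this, abs_of_pos hs, smul_eq_mul, ← integral_const_mul, ← integral_const_mul]
    congr 1
    funext u
    simp only [gaussianPDFReal, X, smul_eq_mul, ENNReal.toReal_ofReal (hρ_bdd u).1]
    have e : -(s * u - 0) ^ 2 / (2 * ((1 : NNReal) : ℝ)) = s ^ 2 * (-u ^ 2 / 2) := by
      simp; ring
    rw [e]
    simp; ring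
  intro s hs
  have h1 : AnalyticAt ℝ (fun s : ℝ => s * (√(2 * Real.pi))⁻¹ * mgf X μ (s ^ 2)) s := by
    have h2 : AnalyticAt ℝ (mgf X μ) (s ^ 2) :=
      analyticAt_mgf (hint' (by have : 0 < s := hs; show 0 < s ^ 2; positivity))
    have h3 : AnalyticAt ℝ (fun s : ℝ => s ^ 2) s := by fun_prop
    have h4 : AnalyticAt ℝ (fun s : ℝ => mgf X μ (s ^ 2)) s := h2.comp_of_eq h3 rfl
    exact (analyticAt_id.mul analyticAt_const).mul h4
  refine h1.congr ?_
  filter_upwards [isOpen_Ioi.mem_nhds hs] with x hx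
  exact (heq x hx).symm

set_option maxHeartbeats 4000000 in
/-- Theorem 6.3: Under (A3), (A4), convexity of g, g(σ_M) < b and
condition (6.29), one has c₁ < 1/φ(σ_{b,0}) = c_o, and for every c ∈ (c₁, c_o] the
CM-estimate dominates the S-estimate: B_CM(ε) ≤ B_S(ε) for all ε ∈ (0,b) with strict
inequality for at least one ε. -/
theorem stmt16 (ρ : ℝ → ℝ)
    (hρ_meas : Measurable ρ)
    (hρ_even : ∀ u, ρ (-u) = ρ u)
    (hρ_mono : MonotoneOn ρ (Set.Ici 0))
    (hρ_zero : ρ 0 = 0)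
    (hρ_bdd : ∀ u, 0 ≤ ρ u ∧ ρ u ≤ 1)
    (hρ_lim : Tendsto ρ atTop (nhds 1))
    (g : ℝ → ℝ)
    (hg : ∀ s, 0 < s → g s = ∫ z, ρ (z / s) ∂(gaussianReal 0 1))
    -- Condition (A4):
    (g' : ℝ → ℝ)
    (hg_deriv : ∀ s ∈ Set.Ioi (0 : ℝ), HasDerivAt g (g' s) s)
    (hg'_cont : ContinuousOn g' (Set.Ioi 0))
    (φ : ℝ → ℝ) (hφ : ∀ s, φ s = -s * g' s)
    (hφ_pos : ∀ s ∈ Set.Ioi (0 : ℝ), 0 < φ s)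
    (σM : ℝ) (hσM : 0 < σM)
    (hφ_mono : MonotoneOn φ (Set.Ioc 0 σM))
    (hφ_anti : AntitoneOn φ (Set.Ici σM))
    (b : ℝ) (hb0 : 0 < b) (hb1 : b < 1)
    -- further assumptions of Theorem 6.3:
    (hg_conv : ConvexOn ℝ (Set.Ioi 0) g)
    (hgσM : g σM < b)
    (σb γb : ℝ → ℝ)
    (hσb : ∀ ε ∈ Set.Ico (0 : ℝ) b, 0 < σb ε ∧ g (σb ε) = (b - ε) / (1 - ε))
    (hγb : ∀ ε ∈ Set.Ico (0 : ℝ) b, 0 < γb ε ∧ g (γb ε) = b / (1 - ε))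
    -- condition (6.29):
    (h629 : φ (σb 0) ≥ (1 - g σM) ^ 2 * (1 - b) / (2 - (b + g σM)))
    (cfun : ℝ → ℝ)
    (hcfun : ∀ ε ∈ Set.Ioo (0 : ℝ) b, cfun ε = ε⁻¹ * Real.log (σb ε / γb ε))
    (c₁ : ℝ) (hc₁ : c₁ = Real.log (σM / σb 0) / (b - g σM))
    (A : ℝ → ℝ → ℝ → ℝ) (hA : ∀ c ε s, A c ε s = c * (1 - ε) * g s + Real.log s)
    (D : ℝ → ℝ → ℝ)
    (hD : ∀ c ε, D c ε =
      sInf (A c ε '' Set.Ici (σb ε)) - sInf (A c ε '' Set.Ici (γb ε)))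
    (BS : ℝ → ℝ) (hBS : ∀ ε, BS ε = Real.sqrt ((σb ε / γb ε) ^ 2 - 1))
    (BCM : ℝ → ℝ → ℝ)
    (hBCM : ∀ c ε, BCM c ε = Real.sqrt (Real.exp (2 * c * ε + 2 * D c ε) - 1)) :
    c₁ < 1 / φ (σb 0) ∧ 1 / φ (σb 0) = sInf (cfun '' Set.Ioo 0 b) ∧
      ∀ c : ℝ, c₁ < c → c ≤ sInf (cfun '' Set.Ioo 0 b) →
        (∀ ε ∈ Set.Ioo (0 : ℝ) b, BCM c ε ≤ BS ε) ∧
        (∃ ε ∈ Set.Ioo (0 : ℝ) b, BCM c ε < BS ε) := by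
  have hε0mem : (0:ℝ) ∈ Ico (0:ℝ) b := ⟨le_refl _, hb0⟩
  obtain ⟨hS, hgS⟩ := hσb 0 hε0mem
  simp only [sub_zero, div_one] at hgS
  obtain ⟨S, hSdef⟩ : ∃ S, S = σb 0 := ⟨_, rfl⟩
  rw [← hSdef] at hS hgS h629 hc₁ ⊢
  have hφS : 0 < φ S := hφ_pos S hS
  -- bounds on g
  have hg_nonneg : ∀ s, 0 < s → 0 ≤ g s := by
    intro s hs
    rw [hg s hs]
    exact integral_nonneg fun z => (hρ_bdd _).1
  have hg_le : ∀ s, 0 < s → g s ≤ 1 := by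
    intro s hs
    rw [hg s hs]
    have h := integral_mono_of_nonneg (μ := gaussianReal 0 1)
      (f := fun z => ρ (z / s)) (g := fun _ => (1:ℝ))
      (ae_of_all _ fun z => (hρ_bdd _).1) (integrable_const _)
      (ae_of_all _ fun z => (hρ_bdd _).2)
    simpa using h
  have hg'neg : ∀ s, 0 < s → g' s < 0 := by
    intro s hs
    have := hφ_pos s hs
    rw [hφ] at this
    nlinarith
  have hg_contOn : ContinuousOn g (Ioi 0) := fun s hs =>
    (hg_deriv s hs).continuousAt.continuousWithinAt
  have hg_anti : StrictAntiOn g (Ioi 0) := by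
    apply strictAntiOn_of_deriv_neg (convex_Ioi 0) hg_contOn
    intro x hx
    rw [interior_Ioi] at hx
    rw [(hg_deriv x hx).deriv]
    exact hg'neg x hx
  have hlt_of : ∀ s t, 0 < s → 0 < t → g t < g s → s < t := fun s t hs ht h =>
    (hg_anti.lt_iff_gt ht hs).1 h
  have hle_of : ∀ s t, 0 < s → 0 < t → g t ≤ g s → s ≤ t := fun s t hs ht h =>
    (hg_anti.le_iff_ge ht hs).1 h
  have hg_lt : ∀ s, 0 < s → g s < 1 := by
    intro s hs
    have h2 : g s < g (s / 2) := hg_anti (show 0 < s / 2 by positivity) hs (by linarith)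
    linarith [hg_le (s / 2) (by positivity)]
  have hSM : S < σM := hlt_of S σM hS hσM (by rw [hgS]; exact hgσM)
  have hm1 : g σM < 1 := hg_lt σM hσM
  have hφb : (1 - b) ^ 2 / 2 < φ S := by
    refine lt_of_lt_of_le ?_ h629
    rw [lt_div_iff₀ (by linarith)]
    have h1 : 0 < 1 - b := by linarith
    have h2 : 1 - b < 1 - g σM := by linarith
    have h3 : (1 - b) * ((1 - b) + (1 - g σM)) < 2 * (1 - g σM) ^ 2 := by nlinarith
    nlinarith
  -- derivative of k g + log
  have hder : ∀ k s, 0 < s → HasDerivAt (fun x => k * g x + Real.log x) (k * g' s + s⁻¹) s :=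
    fun k s hs => ((hg_deriv s hs).const_mul k).add (Real.hasDerivAt_log hs.ne')
  have hderval : ∀ k s, 0 < s → k * g' s + s⁻¹ = (1 - k * φ s) / s := by
    intro k s hs
    rw [hφ]; field_simp; ring
  have hcont : ∀ k, ContinuousOn (fun x => k * g x + Real.log x) (Ioi 0) := fun k s hs =>
    (hder k s hs).continuousAt.continuousWithinAt
  have hmono : ∀ k, 0 ≤ k → k * φ S ≤ 1 → ∀ s t, 0 < s → s ≤ t → t ≤ S →
      k * g s + Real.log s ≤ k * g t + Real.log t := by
    intro k hk hkφ s t hs hst htS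
    have hpos : ∀ x ∈ Icc s t, 0 < x := fun x hx => lt_of_lt_of_le hs hx.1
    have h : MonotoneOn (fun x => k * g x + Real.log x) (Icc s t) := by
      apply monotoneOn_of_deriv_nonneg (convex_Icc s t) ((hcont k).mono hpos)
      · intro x hx
        exact (hder k x (hpos x (interior_subset hx))).differentiableAt.differentiableWithinAt
      · intro x hx
        have hx' := interior_subset hx
        have hx0 := hpos x hx'
        rw [(hder k x hx0).deriv, hderval k x hx0]
        have h1 : φ x ≤ φ S := hφ_mono ⟨hx0, by linarith [hx'.2]⟩ ⟨hS, hSM.le⟩ (by linarith [hx'.2])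
        have h2 : k * φ x ≤ k * φ S := mul_le_mul_of_nonneg_left h1 hk
        apply div_nonneg _ hx0.le
        linarith
    exact h ⟨le_refl _, hst⟩ ⟨hst, le_refl _⟩ hst
  have hantiOn : ∀ k r t, 0 ≤ k → 0 < r → 1 ≤ k * φ r → t ≤ σM →
      AntitoneOn (fun x => k * g x + Real.log x) (Icc r t) := by
    intro k r t hk hr hkφ htM
    have hpos : ∀ x ∈ Icc r t, 0 < x := fun x hx => lt_of_lt_of_le hr hx.1
    apply antitoneOn_of_deriv_nonpos (convex_Icc r t) ((hcont k).mono hpos)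
    · intro x hx
      exact (hder k x (hpos x (interior_subset hx))).differentiableAt.differentiableWithinAt
    · intro x hx
      have hx' := interior_subset hx
      have hx0 := hpos x hx'
      rw [(hder k x hx0).deriv, hderval k x hx0]
      have h1 : φ r ≤ φ x := hφ_mono ⟨hr, by linarith [hx'.1, hx'.2]⟩
        ⟨hx0, by linarith [hx'.2]⟩ hx'.1
      have h2 : k * φ r ≤ k * φ x := mul_le_mul_of_nonneg_left h1 hk
      apply div_nonpos_of_nonpos_of_nonneg _ hx0.le
      linarith
  -- basic facts on ε
  have hε_facts : ∀ ε ∈ Ioo (0:ℝ) b, 0 < σb ε ∧ 0 < γb ε ∧ g (σb ε) = (b - ε) / (1 - ε) ∧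
      g (γb ε) = b / (1 - ε) ∧ ε < 1 ∧ γb ε < S ∧ S < σb ε := by
    intro ε hε
    obtain ⟨h1, h2⟩ := hσb ε ⟨hε.1.le, hε.2⟩
    obtain ⟨h3, h4⟩ := hγb ε ⟨hε.1.le, hε.2⟩
    have hε1 : ε < 1 := hε.2.trans hb1
    have h0 := hε.1
    refine ⟨h1, h3, h2, h4, hε1, ?_, ?_⟩
    · apply hlt_of _ _ h3 hS
      rw [hgS, h4, lt_div_iff₀ (by linarith)]
      nlinarith
    · apply hlt_of _ _ hS h1
      rw [hgS, h2, div_lt_iff₀ (by linarith)]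
      nlinarith
  -- key inequality
  have hkey : ∀ ε ∈ Ioo (0:ℝ) b, ∀ c, c ≤ 1 / φ S → ∀ s, S ≤ s → s ≤ σb ε →
      c * b + Real.log (γb ε) < c * (1 - ε) * g s + Real.log s := by
    intro ε hε c hc s hSs hsσ
    obtain ⟨h1, h2, h3, h4, hε1, h5, h6⟩ := hε_facts ε hε
    have hs : 0 < s := lt_of_lt_of_le hS hSs
    have h1ε : 0 < 1 - ε := by linarith
    have hgsb : g s ≤ b := by
      rw [← hgS]; exact hg_anti.antitoneOn hS hs hSs
    have hgsσ : (b - ε) / (1 - ε) ≤ g s := by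
      rw [← h3]; exact hg_anti.antitoneOn hs h1 hsσ
    -- convexity
    have hconv : b - g s ≤ φ S * (s / S - 1) := by
      rcases hSs.eq_or_lt with h | h
      · rw [← h, hgS, div_self hS.ne']; simp
      · have := hg_conv.le_slope_of_hasDerivAt hS hs h (hg_deriv S hS)
        rw [slope_def_field, le_div_iff₀ (by linarith), hgS] at this
        have e : φ S * (s / S - 1) = - (g' S * (s - S)) := by
          rw [hφ]; field_simp
        rw [e]; linarith
    have hy0 : 0 ≤ (b - g s) / φ S := div_nonneg (by linarith) hφS.le
    have hys : 1 + (b - g s) / φ S ≤ s / S := by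
      have : (b - g s) / φ S ≤ s / S - 1 := by
        rw [div_le_iff₀ hφS]; linarith
      linarith
    have hlog1 : Real.log (1 + (b - g s) / φ S) ≤ Real.log s - Real.log S := by
      rw [← Real.log_div hs.ne' hS.ne']
      exact Real.log_le_log (by linarith) hys
    have hlog2 := hmono (1 / φ S) (by positivity) (by rw [one_div_mul_cancel hφS.ne'])
      (γb ε) S h2 h5.le (le_refl _)
    rw [h4, hgS] at hlog2
    have hnum := aux_num ε b (φ S) ((b - g s) / φ S) hε.1 hε1 hb0 hb1 hφb hy0 (by
      have : b - g s ≤ ε * (1 - b) / (1 - ε) := by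
        have e : b - (b - ε) / (1 - ε) = ε * (1 - b) / (1 - ε) := by field_simp; ring
        linarith
      calc (b - g s) / φ S ≤ (ε * (1 - b) / (1 - ε)) / φ S :=
            div_le_div_of_nonneg_right this hφS.le
        _ = _ := by rw [div_div])
    have e : (1 - ε) * ((b - g s) / φ S) - ε ^ 2 * b / ((1 - ε) * φ S)
        + 1 / φ S * (b / (1 - ε)) - 1 / φ S * b = 1 / φ S * (b - (1 - ε) * g s) := by
      field_simp; ring
    have hnn : 0 ≤ b - (1 - ε) * g s := by
      have := hg_nonneg s hs
      nlinarith [hε.1]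
    have hcc := mul_le_mul_of_nonneg_right hc hnn
    nlinarith
  have hlow : ∀ ε ∈ Ioo (0:ℝ) b, ∀ c, 0 ≤ c → c ≤ 1 / φ S → ∀ s, γb ε ≤ s → s ≤ σb ε →
      c * b + Real.log (γb ε) ≤ c * (1 - ε) * g s + Real.log s := by
    intro ε hε c hc0 hc s hγs hsσ
    obtain ⟨h1, h2, h3, h4, hε1, h5, h6⟩ := hε_facts ε hε
    rcases le_total S s with h | h
    · exact (hkey ε hε c hc s h hsσ).le
    · have h1ε : 0 < 1 - ε := by linarith
      have hcφ : c * φ S ≤ 1 := by rwa [le_div_iff₀ hφS] at hc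
      have := hmono (c * (1 - ε)) (by positivity) (by
        have : 0 ≤ c * φ S := by positivity
        nlinarith [hε.1]) (γb ε) s h2 hγs h
      rw [h4] at this
      have e : c * (1 - ε) * (b / (1 - ε)) = c * b := by field_simp
      linarith
  have hstrict : ∀ ε ∈ Ioo (0:ℝ) b, ∀ c, c ≤ 1 / φ S → c * ε < Real.log (σb ε / γb ε) := by
    intro ε hε c hc
    obtain ⟨h1, h2, h3, h4, hε1, h5, h6⟩ := hε_facts ε hε
    have := hkey ε hε c hc (σb ε) h6.le (le_refl _)
    rw [h3] at this
    have h1ε : 0 < 1 - ε := by linarith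
    have e : c * (1 - ε) * ((b - ε) / (1 - ε)) = c * b - c * ε := by field_simp
    rw [Real.log_div h1.ne' h2.ne']
    linarith
  -- small ε
  have hsmall : ∀ r, 0 < r → r < S → ∃ δ, 0 < δ ∧ δ < b ∧ ∀ ε, 0 < ε → ε < δ →
      r < γb ε ∧ σb ε < σM := by
    intro r hr hrS
    have hgr : b < g r := by rw [← hgS]; exact hg_anti hr hS hrS
    have hm0 := hg_nonneg σM hσM
    refine ⟨min (b - g σM) (1 - b / g r) / 2, ?_, ?_, ?_⟩
    · have : b / g r < 1 := by rw [div_lt_one (by linarith)]; exact hgr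
      have := lt_min (show 0 < b - g σM by linarith) (show 0 < 1 - b / g r by linarith)
      linarith
    · have := min_le_left (b - g σM) (1 - b / g r)
      linarith
    · intro ε hε hεδ
      have hl := min_le_left (b - g σM) (1 - b / g r)
      have hr' := min_le_right (b - g σM) (1 - b / g r)
      have hlt0 : 0 < min (b - g σM) (1 - b / g r) := by linarith
      have hεb : ε ∈ Ioo (0:ℝ) b := ⟨hε, by linarith⟩
      obtain ⟨h1, h2, h3, h4, hε1, h5, h6⟩ := hε_facts ε hεb
      constructor
      · apply hlt_of _ _ hr h2
        rw [h4, div_lt_iff₀ (by linarith)]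
        have : b / g r < 1 - ε := by linarith
        rw [div_lt_iff₀ (by linarith)] at this
        linarith
      · apply hlt_of _ _ h1 hσM
        rw [h3, lt_div_iff₀ (by linarith)]
        nlinarith
  have hφcont : ContinuousAt φ S := by
    have : φ = fun s => -s * g' s := funext hφ
    rw [this]
    exact (continuousAt_id.neg).mul (hg'_cont.continuousAt (Ioi_mem_nhds hS))
  -- c_o
  have hbdd : BddBelow (cfun '' Ioo 0 b) := by
    refine ⟨1 / φ S, ?_⟩
    rintro _ ⟨ε, hε, rfl⟩
    rw [hcfun ε hε, inv_mul_eq_div, le_div_iff₀ hε.1]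
    exact (hstrict ε hε _ (le_refl _)).le
  have hco : 1 / φ S = sInf (cfun '' Ioo 0 b) := by
    symm
    apply csInf_eq_of_forall_ge_of_forall_gt_exists_lt
    · exact ⟨_, mem_image_of_mem _ ⟨by positivity, (by linarith : b / 2 < b)⟩⟩
    · rintro _ ⟨ε, hε, rfl⟩
      rw [hcfun ε hε, inv_mul_eq_div, le_div_iff₀ hε.1]
      exact (hstrict ε hε _ (le_refl _)).le
    · intro w hw
      -- choose r < S with 1 / φ r < w
      have hev : ∀ᶠ r in nhds S, 1 / φ r < w :=
        ((continuousAt_const.div hφcont hφS.ne').eventually_lt continuousAt_const hw)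
      obtain ⟨r, hr1, hr2, hr0⟩ : ∃ r, 1 / φ r < w ∧ r < S ∧ 0 < r := by
        have h1 : ∀ᶠ r in nhdsWithin S (Iio S), 1 / φ r < w := hev.filter_mono nhdsWithin_le_nhds
        have h2 : ∀ᶠ r in nhdsWithin S (Iio S), r < S := self_mem_nhdsWithin
        have h3 : ∀ᶠ r in nhdsWithin S (Iio S), 0 < r :=
          (eventually_gt_nhds hS).filter_mono nhdsWithin_le_nhds
        exact (h1.and (h2.and h3)).exists
      obtain ⟨δ, hδ0, hδb, hδ⟩ := hsmall r hr0 hr2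
      have hφr : 0 < φ r := hφ_pos r hr0
      have hw0 : 0 < w := lt_trans (by positivity) hr1
      have hwr : 1 / φ r / w < 1 := by rw [div_lt_one hw0]; exact hr1
      obtain ⟨ε, hεdef⟩ : ∃ ε, ε = min δ (1 - 1 / φ r / w) / 2 := ⟨_, rfl⟩
      have hmin := lt_min hδ0 (show 0 < 1 - 1 / φ r / w by linarith)
      have hε0 : 0 < ε := by rw [hεdef]; linarith
      have hεδ : ε < δ := by
        have := min_le_left δ (1 - 1 / φ r / w)
        linarith
      have hεw : 1 / φ r / w < 1 - ε := by
        have := min_le_right δ (1 - 1 / φ r / w)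
        linarith
      have hεb : ε ∈ Ioo (0:ℝ) b := ⟨hε0, hεδ.trans hδb⟩
      obtain ⟨h1, h2, h3, h4, hε1, h5, h6⟩ := hε_facts ε hεb
      obtain ⟨h7, h8⟩ := hδ ε hε0 hεδ
      refine ⟨cfun ε, mem_image_of_mem _ hεb, ?_⟩
      rw [hcfun ε hεb, inv_mul_eq_div, div_lt_iff₀ hε0, Real.log_div h1.ne' h2.ne']
      have ha := hantiOn (1 / φ r) r (σb ε) (by positivity) hr0
        (by rw [one_div_mul_cancel hφr.ne']) h8.le
        (show γb ε ∈ Icc r (σb ε) from ⟨h7.le, by linarith⟩)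
        (show σb ε ∈ Icc r (σb ε) from ⟨by linarith, le_refl _⟩) (by linarith)
      simp only [h3, h4] at ha
      have h1ε : 0 < 1 - ε := by linarith
      have e : 1 / φ r * (b / (1 - ε)) - 1 / φ r * ((b - ε) / (1 - ε)) =
          1 / φ r / (1 - ε) * ε := by field_simp; ring
      have h9 : 1 / φ r / (1 - ε) < w := by
        rw [div_lt_iff₀ h1ε]
        rw [div_lt_iff₀ hw0] at hεw
        linarith
      have h10 := mul_lt_mul_of_pos_right h9 hε0
      linarith
  -- c₁
  have hbm : 0 < b - g σM := by linarith
  have hc₁pos : 0 < c₁ := by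
    rw [hc₁]
    apply div_pos (Real.log_pos _) hbm
    rwa [one_lt_div hS]
  have hc₁lt : c₁ < 1 / φ S := by
    rw [hc₁, div_lt_iff₀ hbm, Real.log_div hσM.ne' hS.ne']
    have hAnti := hantiOn (1 / φ S) S σM (by positivity) hS
        (by rw [one_div_mul_cancel hφS.ne']) (le_refl _)
    by_contra hcon
    push Not at hcon
    have hconst : ∀ x ∈ Icc S σM, g x = b + φ S * Real.log S - φ S * Real.log x := by
      intro x hx
      have h1 := hAnti ⟨le_refl _, hSM.le⟩ hx hx.1
      have h2 := hAnti hx ⟨hSM.le, le_refl _⟩ hx.2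
      simp only [hgS] at h1 h2
      have h3 : 1 / φ S * g x + Real.log x = 1 / φ S * b + Real.log S := by linarith
      field_simp at h3
      linarith
    have hana := aux_analytic ρ hρ_meas hρ_bdd g hg
    have hana2 : AnalyticOnNhd ℝ (fun x => b + φ S * Real.log S - φ S * Real.log x) (Ioi 0) := by
      intro x hx
      exact analyticAt_const.sub (analyticAt_const.mul (analyticAt_log hx))
    have hmid : (S + σM) / 2 ∈ Ioi (0:ℝ) := show 0 < (S + σM) / 2 by linarith
    have heq := hana.eqOn_of_preconnected_of_eventuallyEq hana2 isPreconnected_Ioi hmid (by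
      filter_upwards [Icc_mem_nhds (show S < (S + σM) / 2 by linarith)
        (show (S + σM) / 2 < σM by linarith)] with x hx
      exact hconst x hx)
    obtain ⟨x, hxdef⟩ : ∃ x, x = Real.exp (Real.log S - 1 / φ S) := ⟨_, rfl⟩
    have hx0 : 0 < x := by rw [hxdef]; exact Real.exp_pos _
    have h1 := heq hx0
    have h2 : Real.log x = Real.log S - 1 / φ S := by rw [hxdef, Real.log_exp]
    have h3 := hg_le x hx0
    simp only [h2] at h1
    have h4 : φ S * (Real.log S - 1 / φ S) = φ S * Real.log S - 1 := by field_simp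
    linarith
  refine ⟨hc₁lt, hco, ?_⟩
  intro c hc₁c hcco
  rw [← hco] at hcco
  have hc0 : 0 < c := hc₁pos.trans hc₁c
  -- boundedness
  have hAbdd : ∀ ε ∈ Ioo (0:ℝ) b, ∀ r, 0 < r → BddBelow (A c ε '' Ici r) := by
    intro ε hε r hr
    refine ⟨Real.log r, ?_⟩
    rintro _ ⟨s, hs, rfl⟩
    have hs : r ≤ s := hs
    rw [hA]
    have h1 := Real.log_le_log hr hs
    have h2 := hg_nonneg s (by linarith)
    have h3 : 0 ≤ c * (1 - ε) * g s :=
      mul_nonneg (mul_nonneg hc0.le (by linarith [hε.2])) h2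
    linarith
  have hAγ : ∀ ε ∈ Ioo (0:ℝ) b, A c ε (γb ε) = c * b + Real.log (γb ε) := by
    intro ε hε
    obtain ⟨h1, h2, h3, h4, hε1, h5, h6⟩ := hε_facts ε hε
    have h1ε : 1 - ε ≠ 0 := by linarith
    rw [hA, h4]; field_simp
  have hAσ : ∀ ε ∈ Ioo (0:ℝ) b, A c ε (σb ε) = c * b - c * ε + Real.log (σb ε) := by
    intro ε hε
    obtain ⟨h1, h2, h3, h4, hε1, h5, h6⟩ := hε_facts ε hε
    have h1ε : 1 - ε ≠ 0 := by linarith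
    rw [hA, h3]; field_simp
  have hImin : ∀ ε ∈ Ioo (0:ℝ) b,
      min (A c ε (γb ε)) (sInf (A c ε '' Ici (σb ε))) ≤ sInf (A c ε '' Ici (γb ε)) := by
    intro ε hε
    obtain ⟨h1, h2, h3, h4, hε1, h5, h6⟩ := hε_facts ε hε
    apply le_csInf ⟨_, mem_image_of_mem _ self_mem_Ici⟩
    rintro _ ⟨s, hs, rfl⟩
    rcases le_total s (σb ε) with h | h
    · refine (min_le_left _ _).trans ?_
      rw [hAγ ε hε, hA]
      exact hlow ε hε c hc0.le hcco s hs h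
    · exact (min_le_right _ _).trans (csInf_le (hAbdd ε hε _ h1) (mem_image_of_mem _ h))
  have hexp : ∀ ε ∈ Ioo (0:ℝ) b, Real.exp (2 * Real.log (σb ε / γb ε)) = (σb ε / γb ε) ^ 2 := by
    intro ε hε
    obtain ⟨h1, h2, h3, h4, hε1, h5, h6⟩ := hε_facts ε hε
    rw [show (2:ℝ) * Real.log (σb ε / γb ε) = ((2:ℕ):ℝ) * Real.log (σb ε / γb ε) by norm_num,
      Real.exp_nat_mul, Real.exp_log (by positivity)]
  constructor
  · intro ε hε
    obtain ⟨h1, h2, h3, h4, hε1, h5, h6⟩ := hε_facts ε hε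
    rw [hBCM, hBS]
    apply Real.sqrt_le_sqrt
    rw [← hexp ε hε]
    have hst := hstrict ε hε c hcco
    have hDle : D c ε ≤ Real.log (σb ε / γb ε) - c * ε := by
      rw [hD]
      have hI := hImin ε hε
      have hIσ : sInf (A c ε '' Ici (σb ε)) ≤ A c ε (σb ε) :=
        csInf_le (hAbdd ε hε _ h1) (mem_image_of_mem _ self_mem_Ici)
      rcases min_le_iff.1 hI with h | h
      · rw [hAγ ε hε] at h
        rw [hAσ ε hε] at hIσ
        rw [Real.log_div h1.ne' h2.ne']
        linarith
      · linarith
    have : Real.exp (2 * c * ε + 2 * D c ε) ≤ Real.exp (2 * Real.log (σb ε / γb ε)) :=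
      Real.exp_le_exp.2 (by linarith)
    linarith
  · have hgap : Real.log σM - c * (b - g σM) < Real.log S := by
      rw [hc₁, div_lt_iff₀ hbm, Real.log_div hσM.ne' hS.ne'] at hc₁c
      linarith
    obtain ⟨r, hrdef⟩ : ∃ r, r = Real.exp (Real.log σM - c * (b - g σM)) := ⟨_, rfl⟩
    have hr0 : 0 < r := by rw [hrdef]; exact Real.exp_pos _
    have hrlog : Real.log r = Real.log σM - c * (b - g σM) := by rw [hrdef, Real.log_exp]
    have hrS : r < S := by
      rw [← hrlog] at hgap
      exact (Real.log_lt_log_iff hr0 hS).1 hgap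
    obtain ⟨δ, hδ0, hδb, hδ⟩ := hsmall r hr0 hrS
    have hε : δ / 2 ∈ Ioo (0:ℝ) b := ⟨by linarith, by linarith⟩
    obtain ⟨h7, h8⟩ := hδ (δ / 2) (by linarith) (by linarith)
    refine ⟨δ / 2, hε, ?_⟩
    obtain ⟨ε, hεdef⟩ : ∃ ε, ε = δ / 2 := ⟨_, rfl⟩
    rw [← hεdef] at hε h7 h8 ⊢
    obtain ⟨h1, h2, h3, h4, hε1, h5, h6⟩ := hε_facts ε hε
    have hIγ : sInf (A c ε '' Ici (γb ε)) < A c ε (γb ε) := by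
      refine lt_of_le_of_lt (csInf_le (hAbdd ε hε _ h2)
        (mem_image_of_mem _ (show γb ε ≤ σM by linarith))) ?_
      rw [hAγ ε hε, hA]
      have hlog := Real.log_lt_log hr0 h7
      have hm0 := hg_nonneg σM hσM
      have : 0 ≤ c * ε * g σM := mul_nonneg (mul_nonneg hc0.le hε.1.le) hm0
      nlinarith
    have hI : sInf (A c ε '' Ici (σb ε)) ≤ sInf (A c ε '' Ici (γb ε)) := by
      rcases min_le_iff.1 (hImin ε hε) with h | h
      · linarith
      · exact h
    have hst := hstrict ε hε c hcco
    rw [hBCM, hBS]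
    have h12 : 1 < σb ε / γb ε := by rw [one_lt_div h2]; linarith
    rw [Real.sqrt_lt_sqrt_iff_of_pos (by nlinarith), ← hexp ε hε]
    have hDle : D c ε ≤ 0 := by rw [hD]; linarith
    have : Real.exp (2 * c * ε + 2 * D c ε) < Real.exp (2 * Real.log (σb ε / γb ε)) :=
      Real.exp_lt_exp.2 (by linarith)
    linarith
end
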